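/- Let A ∈ ℍ^{m×n}, W ∈ ℍ^{n×m} with k = max{Ind(AW), Ind(WA)}, and let D ∈ ℍ^{q×m}. If every row of D lies in the left row space R_l((AW)^k), then X = D A_{d,W} satisfies X W A W = D, and it is the unique solution X ∈ ℍ^{q×n} of X W A W = D whose rows all lie in the left row space R_l((WA)^k). -/

import Mathlib

open Matrix
open scoped Classical

noncomputable section

local notation "ℍ" => Quaternion ℝ

/-- The product of the entries of `A` along the `σ`-cycle of `j`, taken in forward
order starting at `j`:  `a_{j, σj} · a_{σj, σ²j} ⋯ a_{σ^{l-1}j, j}`. -/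
def cycProd {n : ℕ} (A : Matrix (Fin n) (Fin n) ℍ) (σ : Equiv.Perm (Fin n)) (j : Fin n) : ℍ :=
  ((List.range (Function.minimalPeriod (⇑σ) j)).map
    fun t => A ((σ ^ t) j) ((σ ^ (t + 1)) j)).prod

/-- The minimal elements (leaders) of the `σ`-cycles not containing `i`, in
increasing order. -/
def othersList {n : ℕ} (σ : Equiv.Perm (Fin n)) (i : Fin n) : List (Fin n) :=
  (Finset.univ.filter fun j =>
    ¬ σ.SameCycle i j ∧ ∀ t, σ.SameCycle j t → j ≤ t).sort (· ≤ ·)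

/-- The `i`-th row determinant of a square quaternion matrix: the cycle containing
`i` is written first, starting at `i`; the remaining cycles follow, each starting at
its minimal element, ordered by increasing minimal elements; the sign `(-1)^{n-r}`
is the sign of the permutation. -/
def rdet {n : ℕ} (A : Matrix (Fin n) (Fin n) ℍ) (i : Fin n) : ℍ :=
  ∑ σ : Equiv.Perm (Fin n), ((Equiv.Perm.sign σ : ℤ) •
    (cycProd A σ i * ((othersList σ i).map (cycProd A σ)).prod))

/-- The `j`-th column determinant of a square quaternion matrix (mirror convention:
the cycle containing `j` is written last, ending at `j`; the remaining cycles
precede it, ordered by decreasing minimal elements). -/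
def cdet {n : ℕ} (A : Matrix (Fin n) (Fin n) ℍ) (j : Fin n) : ℍ :=
  ∑ σ : Equiv.Perm (Fin n), ((Equiv.Perm.sign σ : ℤ) •
    ((((othersList σ j).reverse.map (cycProd A σ)).prod) * cycProd A σ j))

/-- The determinant of a (Hermitian) quaternion matrix: all cycles ordered by
increasing minimal elements, each starting at its minimal element.  For Hermitian
matrices this is the common value of all row and column determinants. -/
def qdet {n : ℕ} (A : Matrix (Fin n) (Fin n) ℍ) : ℍ :=
  ∑ σ : Equiv.Perm (Fin n), ((Equiv.Perm.sign σ : ℤ) •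
    (((Finset.univ.filter fun j => ∀ t, σ.SameCycle j t → j ≤ t).sort (· ≤ ·)).map
      (cycProd A σ)).prod)

/-- The principal submatrix of `A` with rows and columns indexed by `β`. -/
def pSub {n : ℕ} (A : Matrix (Fin n) (Fin n) ℍ) (β : Finset (Fin n)) :
    Matrix (Fin β.card) (Fin β.card) ℍ :=
  fun a b => A ((β.orderIsoOfFin rfl) a) ((β.orderIsoOfFin rfl) b)

/-- `|A^β_β|`, the determinant of the principal submatrix indexed by `β`. -/
def minorDet {n : ℕ} (A : Matrix (Fin n) (Fin n) ℍ) (β : Finset (Fin n)) : ℍ :=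
  qdet (pSub A β)

/-- `cdet_i ((A)^β_β)` for `i ∈ β`. -/
def minorCdet {n : ℕ} (A : Matrix (Fin n) (Fin n) ℍ) (β : Finset (Fin n)) (i : Fin n) : ℍ :=
  if h : i ∈ β then cdet (pSub A β) ((β.orderIsoOfFin rfl).symm ⟨i, h⟩) else 0

/-- `rdet_j ((A)^α_α)` for `j ∈ α`. -/
def minorRdet {n : ℕ} (A : Matrix (Fin n) (Fin n) ℍ) (α : Finset (Fin n)) (j : Fin n) : ℍ :=
  if h : j ∈ α then rdet (pSub A α) ((α.orderIsoOfFin rfl).symm ⟨j, h⟩) else 0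

/-- The rank of a quaternion matrix: the dimension of its (left) row space. -/
def qrank {m n : ℕ} (A : Matrix (Fin m) (Fin n) ℍ) : ℕ :=
  Module.finrank ℍ (Submodule.span ℍ (Set.range A))

/-- `Ind A`: the smallest `k` with `rank A^{k+1} = rank A^k`. -/
def qindex {n : ℕ} (A : Matrix (Fin n) (Fin n) ℍ) : ℕ :=
  sInf {k | qrank (A ^ (k + 1)) = qrank (A ^ k)}

/-- `X` is the Moore–Penrose inverse of `A`. -/
def IsMP {m n : ℕ} (A : Matrix (Fin m) (Fin n) ℍ) (X : Matrix (Fin n) (Fin m) ℍ) : Prop :=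
  A * X * A = A ∧ X * A * X = X ∧ (A * X)ᴴ = A * X ∧ (X * A)ᴴ = X * A

/-- `X` is the Drazin inverse of `A`. -/
def IsDrazin {n : ℕ} (A X : Matrix (Fin n) (Fin n) ℍ) : Prop :=
  X * A * X = X ∧ A * X = X * A ∧ A ^ (qindex A + 1) * X = A ^ qindex A

/-- `X` is the W-weighted Drazin inverse of `A` with respect to `W`. -/
def IsWDrazin {m n : ℕ} (A : Matrix (Fin m) (Fin n) ℍ) (W : Matrix (Fin n) (Fin m) ℍ)
    (X : Matrix (Fin m) (Fin n) ℍ) : Prop :=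
  (A * W) ^ (max (qindex (A * W)) (qindex (W * A)) + 1) * X * W
      = (A * W) ^ max (qindex (A * W)) (qindex (W * A)) ∧
  X * W * A * W * X = X ∧ A * W * X = X * W * A

/-- A matrix whose rows are left combinations of the rows of `M` is a left multiple of `M`. -/
lemma exists_eq_mul_of_rows {q m n : ℕ} {D : Matrix (Fin q) (Fin n) ℍ}
    {M : Matrix (Fin m) (Fin n) ℍ}
    (h : ∀ i : Fin q, ∃ y : Fin m → ℍ, (fun c => D i c) = Matrix.vecMul y M) :
    ∃ Y : Matrix (Fin q) (Fin m) ℍ, D = Y * M := by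
  choose Y hY using h
  exact ⟨Y, by ext1 i c; exact congrFun (hY i) c⟩

/-- The rows of `T * M` lie in the left row space of `M`. -/
lemma span_rows_mul_le {q m n : ℕ} (T : Matrix (Fin q) (Fin m) ℍ)
    (M : Matrix (Fin m) (Fin n) ℍ) :
    Submodule.span ℍ (Set.range (T * M)) ≤ Submodule.span ℍ (Set.range M) := by
  rw [Submodule.span_le]
  rintro _ ⟨i, rfl⟩
  have h : (T * M) i = ∑ j, T i j • M j := by
    ext1 c
    simp [Matrix.mul_apply, Finset.sum_apply]
  rw [h]
  exact Submodule.sum_mem _ fun j _ =>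
    Submodule.smul_mem _ _ (Submodule.subset_span ⟨j, rfl⟩)

lemma qrank_mul_le_right {q m n : ℕ} (T : Matrix (Fin q) (Fin m) ℍ)
    (M : Matrix (Fin m) (Fin n) ℍ) : qrank (T * M) ≤ qrank M :=
  Submodule.finrank_mono (span_rows_mul_le T M)

/-- If left multiplication by `T` preserves the rank of `M`, then `M` is a left multiple
of `T * M`. -/
lemma exists_eq_mul_of_qrank_eq {q m n : ℕ} {T : Matrix (Fin q) (Fin m) ℍ}
    {M : Matrix (Fin m) (Fin n) ℍ} (h : qrank (T * M) = qrank M) :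
    ∃ S : Matrix (Fin m) (Fin q) ℍ, M = S * (T * M) := by
  have hs := Submodule.eq_of_le_of_finrank_eq (span_rows_mul_le T M) h
  refine exists_eq_mul_of_rows fun i => ?_
  have hi : M i ∈ Submodule.span ℍ (Set.range (T * M)) :=
    hs ▸ Submodule.subset_span ⟨i, rfl⟩
  obtain ⟨y, hy⟩ := (Submodule.mem_span_range_iff_exists_fun ℍ).1 hi
  refine ⟨y, ?_⟩
  ext1 c
  rw [← hy]
  simp [Matrix.vecMul, dotProduct, Finset.sum_apply]

/-- The index of a square matrix is attained. -/
lemma qrank_pow_qindex_succ {n : ℕ} (Q : Matrix (Fin n) (Fin n) ℍ) :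
    qrank (Q ^ (qindex Q + 1)) = qrank (Q ^ qindex Q) := by
  have hne : {k | qrank (Q ^ (k + 1)) = qrank (Q ^ k)}.Nonempty := by
    by_contra hempty
    rw [Set.not_nonempty_iff_eq_empty, Set.eq_empty_iff_forall_notMem] at hempty
    refine not_strictAnti_of_wellFoundedLT (fun k => qrank (Q ^ k)) (strictAnti_nat_of_succ_lt ?_)
    intro k
    refine lt_of_le_of_ne ?_ (hempty k)
    rw [pow_succ']
    exact qrank_mul_le_right Q (Q ^ k)
  exact Nat.sInf_mem hne

/-- From the index on, each power of `Q` is a left multiple of the next one. -/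
lemma exists_pow_eq_mul_pow_succ {n k : ℕ} {Q : Matrix (Fin n) (Fin n) ℍ}
    (hk : qindex Q ≤ k) : ∃ S : Matrix (Fin n) (Fin n) ℍ, Q ^ k = S * Q ^ (k + 1) := by
  have h := qrank_pow_qindex_succ Q
  rw [pow_succ'] at h
  obtain ⟨S, hS⟩ := exists_eq_mul_of_qrank_eq h
  refine ⟨S, ?_⟩
  obtain ⟨d, rfl⟩ := Nat.exists_eq_add_of_le hk
  rw [pow_succ', pow_add, ← mul_assoc Q, ← mul_assoc S, ← hS]

/-- If `B * C = C * E`, then `B ^ k * C = C * E ^ k`, for rectangular `C`. -/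
lemma pow_mul_eq_mul_pow {m n : ℕ} {B : Matrix (Fin m) (Fin m) ℍ}
    {C : Matrix (Fin m) (Fin n) ℍ} {E : Matrix (Fin n) (Fin n) ℍ} (h : B * C = C * E) (k : ℕ) :
    B ^ k * C = C * E ^ k := by
  induction k with
  | zero => simp
  | succ k ih =>
    rw [pow_succ, pow_succ', Matrix.mul_assoc, h, ← Matrix.mul_assoc, ih, Matrix.mul_assoc,
      ← pow_succ, pow_succ']

/-- The power identity of the W-weighted Drazin inverse on the `W * A` side. -/
lemma pow_succ_mul_mul_of_isWDrazin {m n k : ℕ} {A : Matrix (Fin m) (Fin n) ℍ}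
    {W : Matrix (Fin n) (Fin m) ℍ} {G : Matrix (Fin m) (Fin n) ℍ}
    (hk : qindex (W * A) ≤ k) (hpow : (A * W) ^ (k + 1) * G * W = (A * W) ^ k)
    (hcomm : A * W * G = G * W * A) :
    (W * A) ^ (k + 1) * W * G = (W * A) ^ k := by
  have hW : ∀ j, (W * A) ^ j * W = W * (A * W) ^ j :=
    pow_mul_eq_mul_pow (Matrix.mul_assoc W A W)
  have hWG : Commute (W * A) (W * G) := by
    change W * A * (W * G) = W * G * (W * A)
    simp only [Matrix.mul_assoc] at hcomm ⊢
    rw [hcomm]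
  have hzero : (W * A) ^ (k + 1) * ((W * A) * (W * G)) = (W * A) ^ (k + 1) := by
    calc (W * A) ^ (k + 1) * ((W * A) * (W * G))
        = (W * A) ^ (k + 1) * W * G * W * A := by
          rw [hWG.eq]; simp only [Matrix.mul_assoc]
      _ = W * ((A * W) ^ (k + 1) * G * W) * A := by
          rw [hW]; simp only [Matrix.mul_assoc]
      _ = (W * A) ^ (k + 1) := by
          rw [hpow, ← hW, pow_succ, Matrix.mul_assoc]
  obtain ⟨S, hS⟩ := exists_pow_eq_mul_pow_succ hk
  calc (W * A) ^ (k + 1) * W * G = (W * A) ^ k * ((W * A) * (W * G)) := by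
        rw [pow_succ]; simp only [Matrix.mul_assoc]
    _ = S * ((W * A) ^ (k + 1) * ((W * A) * (W * G))) := by
        rw [← Matrix.mul_assoc S, ← hS]
    _ = (W * A) ^ k := by rw [hzero, ← hS]

/-- The W-weighted Drazin inverse solution of the restricted
matrix equation `XWAW = D`. -/
theorem wdrazin_solution_XWAW {m n q : ℕ} (k : ℕ) (A : Matrix (Fin m) (Fin n) ℍ)
    (W : Matrix (Fin n) (Fin m) ℍ)
    (hk : k = max (qindex (A * W)) (qindex (W * A)))
    (D : Matrix (Fin q) (Fin m) ℍ)
    (hD : ∀ i : Fin q, ∃ y : Fin m → ℍ,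
      (fun c => D i c) = Matrix.vecMul y ((A * W) ^ k))
    (G : Matrix (Fin m) (Fin n) ℍ) (hG : IsWDrazin A W G) :
    (D * G) * W * A * W = D ∧
    (∀ i : Fin q, ∃ y : Fin n → ℍ,
      (fun c => (D * G) i c) = Matrix.vecMul y ((W * A) ^ k)) ∧
    (∀ X : Matrix (Fin q) (Fin n) ℍ, X * W * A * W = D →
      (∀ i : Fin q, ∃ y : Fin n → ℍ,
        (fun c => X i c) = Matrix.vecMul y ((W * A) ^ k)) →
      X = D * G) := by
  obtain ⟨hpow, -, hcomm⟩ := hG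
  rw [← hk] at hpow
  obtain ⟨Y, rfl⟩ := exists_eq_mul_of_rows hD
  refine ⟨?_, fun i => ⟨(Y * G) i, ?_⟩, fun X hX hrows => ?_⟩
  · calc Y * (A * W) ^ k * G * W * A * W = Y * (A * W) ^ k * (G * W * A) * W := by
          simp only [Matrix.mul_assoc]
      _ = Y * ((A * W) ^ (k + 1) * G * W) := by
          rw [← hcomm, pow_succ]; simp only [Matrix.mul_assoc]
      _ = Y * (A * W) ^ k := by rw [hpow]
  · have hG' : (A * W) ^ k * G = G * (W * A) ^ k :=
      pow_mul_eq_mul_pow (by rw [hcomm, Matrix.mul_assoc]) k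
    have h : Y * (A * W) ^ k * G = Y * G * (W * A) ^ k := by
      rw [Matrix.mul_assoc, hG', Matrix.mul_assoc]
    rw [h]
    rfl
  · obtain ⟨Z, rfl⟩ := exists_eq_mul_of_rows hrows
    have hQ := pow_succ_mul_mul_of_isWDrazin (hk ▸ le_max_right _ _) hpow hcomm
    calc Z * (W * A) ^ k = Z * ((W * A) ^ (k + 1) * W * G) := by rw [hQ]
      _ = Z * (W * A) ^ k * W * A * W * G := by
          rw [pow_succ]; simp only [Matrix.mul_assoc]
      _ = Y * (A * W) ^ k * G := by rw [hX]
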